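/- Let n, k, i be integers with n ≥ 2k > 0 and 3 ≤ i ≤ k. Then (binom(n-1, k-1) + binom(n-i, k-i+1))·(binom(n-1, k-1) − binom(n-i, k-1)) ≤ (binom(n-1, k-1) + binom(n-i-1, k-i))·(binom(n-1, k-1) − binom(n-i-1, k-1)); that is, the bound (binom(n-1,k-1) + binom(n-i,k-i+1))·(binom(n-1,k-1) − binom(n-i,k-1)) is non-increasing as i decreases in the range 3 ≤ i ≤ k+1. -/

import Mathlib

/-- Binomial coefficients increase along each row up to the middle. -/
theorem choose_le_choose_of_le_half {m a b : ℕ} (hab : a ≤ b) (hb : 2 * b ≤ m) :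
    m.choose a ≤ m.choose b := by
  induction b, hab using Nat.le_induction with
  | base => exact le_rfl
  | succ b _ ih =>
    exact (ih (by lia)).trans (Nat.choose_le_succ_of_lt_half_left (by lia))

/-- Of two binomial coefficients in a row, the one nearer to the middle is the larger. -/
theorem choose_le_choose_of_add_le {m a b : ℕ} (hab : a ≤ b) (h : a + b ≤ m) :
    m.choose a ≤ m.choose b := by
  rcases le_total (2 * b) m with hb | hb
  · exact choose_le_choose_of_le_half hab hb
  · rw [← Nat.choose_symm (show b ≤ m by lia)]
    exact choose_le_choose_of_le_half (by lia) (by lia)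

/-- Monotonicity of the bound in Theorem 2: for integers `n ≥ 2k > 0` and
`3 ≤ i ≤ k`, the bound `(binom(n-1,k-1)+binom(n-i,k-i+1))·(binom(n-1,k-1)−binom(n-i,k-1))`
at `i` is at most its value at `i+1`, i.e. it is non-increasing as `i` decreases. -/
theorem bound_monotone (n k i : ℕ) (hk : 0 < k) (hn : 2 * k ≤ n)
    (hi3 : 3 ≤ i) (hik : i ≤ k) :
    ((n - 1).choose (k - 1) + (n - i).choose (k + 1 - i)) *
        ((n - 1).choose (k - 1) - (n - i).choose (k - 1)) ≤
      ((n - 1).choose (k - 1) + (n - i - 1).choose (k - i)) *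
        ((n - 1).choose (k - 1) - (n - i - 1).choose (k - 1)) := by
  have hB : (n - i).choose (k + 1 - i) =
      (n - i - 1).choose (k - i) + (n - i - 1).choose (k - i + 1) := by
    rw [← Nat.choose_succ_succ']
    congr 1 <;> lia
  have hD : (n - i).choose (k - 1) =
      (n - i - 1).choose (k - 2) + (n - i - 1).choose (k - 1) := by
    rw [show k - 1 = k - 2 + 1 by lia, ← Nat.choose_succ_succ']
    congr 1
    lia
  have hpq : (n - i - 1).choose (k - i + 1) ≤ (n - i - 1).choose (k - 2) :=
    choose_le_choose_of_add_le (by lia) (by lia)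
  have hDA : (n - i).choose (k - 1) ≤ (n - 1).choose (k - 1) :=
    Nat.choose_le_choose _ (by lia)
  rw [hD] at hDA
  rw [hB, hD]
  generalize (n - 1).choose (k - 1) = A at *
  generalize (n - i - 1).choose (k - i + 1) = p at *
  generalize (n - i - 1).choose (k - i) = b at *
  generalize (n - i - 1).choose (k - 2) = q at *
  generalize (n - i - 1).choose (k - 1) = d at *
  obtain ⟨c, rfl⟩ := Nat.exists_eq_add_of_le hDA
  rw [Nat.add_sub_cancel_left, show q + d + c - d = q + c by lia]
  have hpc : p * c ≤ q * c := Nat.mul_le_mul_right c hpq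
  nlinarith [Nat.zero_le (q * (q + d + b))]
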